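/- Delta-method form of Theorem 1: let 𝒳 be a nonempty finite set, and for each x ∈ 𝒳 let π*_x be a probability vector on 𝒢; fix q ∈ [1,∞), δ > 0, and m ∈ ℝ^{𝒢×𝒳}. Define φ(f) := ∑_{x∈𝒳} max_{Γ ∈ F(π*_x, δ, q)} ∑_{u,v∈𝒢} Γ(u,v) f(v,x) for f ∈ ℝ^{𝒢×𝒳}, and S*_x := {Γ ∈ F(π*_x, δ, q) : ∑_{u,v} Γ(u,v) m(v,x) = max_{Γ' ∈ F(π*_x,δ,q)} ∑_{u,v} Γ'(u,v) m(v,x)}. Suppose for each n ∈ ℕ, M_n is a random vector in ℝ^{𝒢×𝒳} defined on some probability space, and the law of √n (M_n − m) converges weakly to a Borel probability measure μ on ℝ^{𝒢×𝒳}. Then the law of √n (φ(M_n) − φ(m)) converges weakly to the pushforward of μ under the continuous map h ↦ ∑_{x∈𝒳} max_{Γ ∈ S*_x} ∑_{u,v∈𝒢} Γ(u,v) h(v,x). -/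

import Mathlib

open Filter Topology MeasureTheory

/-- The feasible set `F(π*, δ, q)` of the Wasserstein linear program:
nonnegative `Γ` with first marginal `π*` and transport cost at most `δ^q`. -/
def FeasSet (G : Type) [Fintype G] (val : G → ℕ) (q δ : ℝ) (πx : G → ℝ) :
    Set (G → G → ℝ) :=
  {Γ | (∀ u v, 0 ≤ Γ u v) ∧ (∀ u, ∑ v, Γ u v = πx u) ∧
    ∑ u, ∑ v, Γ u v * |(val u : ℝ) - (val v : ℝ)| ^ q ≤ δ ^ q}

/-- The linear-program value `φ(f) = ∑_x max_{Γ ∈ F(π*_x,δ,q)} ∑_{u,v} Γ(u,v) f(v,x)`. -/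
noncomputable def lpValue (G X : Type) [Fintype G] [Fintype X] (val : G → ℕ)
    (q δ : ℝ) (πstar : X → G → ℝ) (f : G × X → ℝ) : ℝ :=
  ∑ x, sSup ((fun Γ : G → G → ℝ => ∑ u, ∑ v, Γ u v * f (v, x)) ''
    FeasSet G val q δ (πstar x))

/-- The set `S*_x` of maximizers of `Γ ↦ ∑_{u,v} Γ(u,v) m(v,x)` over `F(π*_x,δ,q)`. -/
def SstarSet (G X : Type) [Fintype G] [Fintype X] (val : G → ℕ)
    (q δ : ℝ) (πstar : X → G → ℝ) (m : G × X → ℝ) (x : X) : Set (G → G → ℝ) :=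
  {Γ ∈ FeasSet G val q δ (πstar x) | ∑ u, ∑ v, Γ u v * m (v, x) =
    sSup ((fun Γ' : G → G → ℝ => ∑ u, ∑ v, Γ' u v * m (v, x)) ''
      FeasSet G val q δ (πstar x))}

/-- The (continuous) directional-derivative map
`h ↦ ∑_x max_{Γ ∈ S*_x} ∑_{u,v} Γ(u,v) h(v,x)`. -/
noncomputable def derivMap (G X : Type) [Fintype G] [Fintype X] (val : G → ℕ)
    (q δ : ℝ) (πstar : X → G → ℝ) (m : G × X → ℝ) (h : G × X → ℝ) : ℝ :=
  ∑ x, sSup ((fun Γ : G → G → ℝ => ∑ u, ∑ v, Γ u v * h (v, x)) ''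
    SstarSet G X val q δ πstar m x)

/-- At a point `h`, the difference quotients at `m` of the support function of a compact set of
linear functionals converge, locally uniformly in the direction, to the support function of the
set of functionals which are maximal at `m`. -/
theorem IsCompact.tendsto_supportFunction_slope {A H : Type*} [TopologicalSpace A]
    [TopologicalSpace H] [AddCommGroup H] [Module ℝ H]
    {ℓ : A → H →ₗ[ℝ] ℝ} (hℓ : Continuous fun p : A × H => ℓ p.1 p.2)
    {K : Set A} (hK : IsCompact K) (hne : K.Nonempty) (m h : H) :
    Tendsto (fun p : ℝ × H => p.1⁻¹ *
        (sSup ((fun a => ℓ a (m + p.1 • p.2)) '' K) - sSup ((fun a => ℓ a m) '' K)))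
      (𝓝[>] 0 ×ˢ 𝓝 h)
      (𝓝 (sSup ((fun a => ℓ a h) '' {a ∈ K | ℓ a m = sSup ((fun b => ℓ b m) '' K)}))) := by
  have hc (f : H) : Continuous fun a => ℓ a f :=
    hℓ.comp (continuous_id.prodMk continuous_const)
  have hle (f : H) {a : A} (ha : a ∈ K) : ℓ a f ≤ sSup ((fun b => ℓ b f) '' K) :=
    le_csSup (hK.image (hc f)).bddAbove ⟨a, ha, rfl⟩
  set s := sSup ((fun b => ℓ b m) '' K) with hs
  set S := {a ∈ K | ℓ a m = s} with hS
  obtain ⟨a₀, ha₀, hsa₀⟩ := hK.exists_sSup_image_eq hne (hc m).continuousOn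
  have hSc : IsCompact S := hK.inter_right (isClosed_eq (hc m) continuous_const)
  have hSne : S.Nonempty := ⟨a₀, ha₀, hsa₀.symm⟩
  have hpos : ∀ᶠ p : ℝ × H in 𝓝[>] 0 ×ˢ 𝓝 h, 0 < p.1 :=
    (eventually_mem_nhdsWithin (a := (0 : ℝ)) (s := Set.Ioi 0)).prod_inl _
  have hto : Tendsto (fun p : ℝ × H => p) (𝓝[>] 0 ×ˢ 𝓝 h) (𝓝 (0, h)) := by
    rw [nhds_prod_eq]
    exact Filter.prod_mono_left _ nhdsWithin_le_nhds
  refine tendsto_order.2 ⟨fun c hcT => ?_, fun c hcT => ?_⟩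
  · obtain ⟨a, haS, haT⟩ := hSc.exists_sSup_image_eq hSne (hc h).continuousOn
    rw [haT] at hcT
    have hev : ∀ᶠ p : ℝ × H in 𝓝[>] 0 ×ˢ 𝓝 h, c < ℓ a p.2 :=
      (((hℓ.comp (continuous_const.prodMk continuous_id)).continuousAt.eventually
        (lt_mem_nhds hcT)) : ∀ᶠ x in 𝓝 h, c < ℓ a x).prod_inr _
    filter_upwards [hpos, hev] with p hp hcp
    have h1 := hle (m + p.1 • p.2) haS.1
    rw [map_add, map_smul, haS.2, smul_eq_mul] at h1
    rw [lt_inv_mul_iff₀ hp]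
    nlinarith
  · have hev : ∀ᶠ p : ℝ × H in 𝓝 (0, h), ∀ a ∈ K, a ∈ K → 0 < p.1 →
        ℓ a m + p.1 * ℓ a p.2 < s + p.1 * c := by
      refine hK.eventually_forall_of_forall_eventually fun a ha => ?_
      have hcont : Continuous fun z : (ℝ × H) × A => ℓ z.2 z.1.2 :=
        hℓ.comp (continuous_snd.prodMk (continuous_snd.comp continuous_fst))
      rcases (hle m ha).lt_or_eq with hlt | heq
      · have hl : Continuous fun z : (ℝ × H) × A => ℓ z.2 m + z.1.1 * ℓ z.2 z.1.2 :=
          ((hc m).comp continuous_snd).add ((continuous_fst.comp continuous_fst).mul hcont)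
        have hr : Continuous fun z : (ℝ × H) × A => s + z.1.1 * c := by fun_prop
        filter_upwards [hl.continuousAt.eventually_lt hr.continuousAt
          (x₀ := ((0, h), a)) (by simpa using hlt)] with z hz _ _ using hz
      · have hlt : ℓ a h < c :=
          (le_csSup (hSc.image (hc h)).bddAbove ⟨a, ⟨ha, heq⟩, rfl⟩).trans_lt hcT
        filter_upwards [hcont.continuousAt.eventually_lt (x₀ := ((0, h), a))
          continuousAt_const hlt] with z hz hzK hz0
        nlinarith [hle m hzK]
    filter_upwards [hpos, hto.eventually hev] with p hp hp'
    obtain ⟨a, ha, hmax⟩ := hK.exists_sSup_image_eq hne (hc (m + p.1 • p.2)).continuousOn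
    rw [inv_mul_lt_iff₀ hp, hmax, map_add, map_smul, smul_eq_mul]
    linarith [hp' a ha ha hp]

/-- **Delta method** for a continuous function which is Hadamard directionally differentiable. -/
theorem tendsto_integral_delta_method {H : Type*} [AddCommGroup H] [Module ℝ H]
    [TopologicalSpace H] [TopologicalSpace.PseudoMetrizableSpace H] [SecondCountableTopology H]
    [ContinuousAdd H] [ContinuousSMul ℝ H] [MeasurableSpace H] [BorelSpace H]
    {φ T : H → ℝ} {m : H} (hφ : Continuous φ) (hT : Continuous T)
    (hφT : ∀ h, Tendsto (fun p : ℝ × H => p.1⁻¹ * (φ (m + p.1 • p.2) - φ m))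
      (𝓝[>] 0 ×ˢ 𝓝 h) (𝓝 (T h)))
    {r : ℕ → ℝ} (hr : Tendsto r atTop atTop)
    {Ω : ℕ → Type*} [∀ n, MeasurableSpace (Ω n)]
    (P : ∀ n, Measure (Ω n)) [∀ n, IsProbabilityMeasure (P n)]
    {M : ∀ n, Ω n → H} (hM : ∀ n, Measurable fun ω => r n • (M n ω - m))
    (μ : Measure H) [IsProbabilityMeasure μ]
    (hweak : ∀ f : BoundedContinuousFunction H ℝ,
      Tendsto (fun n => ∫ ω, f (r n • (M n ω - m)) ∂(P n)) atTop (𝓝 (∫ y, f y ∂μ)))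
    (f : BoundedContinuousFunction ℝ ℝ) :
    Tendsto (fun n => ∫ ω, f (r n * (φ (M n ω) - φ m)) ∂(P n)) atTop
      (𝓝 (∫ y, f y ∂(μ.map T))) := by
  let F : NNReal × H → ℝ := fun p =>
    if p.1 = 0 then T p.2 else (p.1 : ℝ)⁻¹ * (φ (m + (p.1 : ℝ) • p.2) - φ m)
  have hF : Continuous F := by
    refine continuous_iff_continuousAt.2 fun ⟨t, h⟩ => ?_
    rcases eq_or_ne t 0 with rfl | ht
    · have hF0 : F (0, h) = T h := if_pos rfl
      rw [ContinuousAt, hF0]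
      refine Tendsto.if ?_ ?_
      · exact ((hT.comp continuous_snd).tendsto (0, h)).mono_left inf_le_left
      · refine (hφT h).comp (f := fun p : NNReal × H => ((p.1 : ℝ), p.2)) ?_
        refine Tendsto.prodMk (tendsto_nhdsWithin_iff.2 ⟨?_, ?_⟩) ?_
        · exact ((NNReal.continuous_coe.comp continuous_fst).tendsto' (0, h) 0 rfl).mono_left
            inf_le_left
        · filter_upwards [mem_inf_of_right (mem_principal_self _)] with p hp
          exact NNReal.coe_pos.2 (pos_iff_ne_zero.2 hp)
        · exact (continuous_snd.tendsto (0, h)).mono_left inf_le_left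
    · have hev : ∀ᶠ p : NNReal × H in 𝓝 (t, h), p.1 ≠ 0 :=
        continuous_fst.continuousAt.eventually_ne ht
      have hc : ContinuousAt (fun p : NNReal × H =>
          (p.1 : ℝ)⁻¹ * (φ (m + (p.1 : ℝ) • p.2) - φ m)) (t, h) := by
        refine ContinuousAt.mul (ContinuousAt.inv₀ (by fun_prop) ?_) (by fun_prop)
        exact NNReal.coe_ne_zero.2 ht
      exact hc.congr (hev.mono fun p hp => (if_neg hp).symm)
  let ν : ℕ → ProbabilityMeasure H := fun n =>
    ⟨(P n).map fun ω => r n • (M n ω - m), Measure.isProbabilityMeasure_map (hM n).aemeasurable⟩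
  let t : ℕ → NNReal := fun n => (r n).toNNReal⁻¹
  have ht : Tendsto t atTop (𝓝 0) :=
    tendsto_inv_atTop_zero.comp (tendsto_real_toNNReal_atTop.comp hr)
  have hν : Tendsto ν atTop (𝓝 ⟨μ, inferInstance⟩) := by
    refine ProbabilityMeasure.tendsto_iff_forall_integral_tendsto.2 fun g => ?_
    refine (hweak g).congr fun n => ?_
    exact (integral_map (hM n).aemeasurable
      g.continuous.measurable.aestronglyMeasurable).symm
  have hprod := (ProbabilityMeasure.continuous_prod.tendsto (diracProba (0 : NNReal),
    (⟨μ, inferInstance⟩ : ProbabilityMeasure H))).comp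
    (((continuous_diracProba.tendsto 0).comp ht).prodMk_nhds hν)
  have hlim := ProbabilityMeasure.tendsto_iff_forall_integral_tendsto.1 hprod
    (f.compContinuous ⟨F, hF⟩)
  have hint (t : NNReal) (ρ : Measure H) [SFinite ρ] :
      ∫ p, f (F p) ∂((Measure.dirac t).prod ρ) = ∫ y, f (F (t, y)) ∂ρ := by
    rw [Measure.dirac_prod]
    exact integral_map measurable_prodMk_left.aemeasurable
      (f.continuous.comp hF).measurable.aestronglyMeasurable
  have hzero : ∫ p, f (F p) ∂((Measure.dirac 0).prod μ) = ∫ y, f y ∂(μ.map T) := by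
    rw [hint, integral_map hT.measurable.aemeasurable
      f.continuous.measurable.aestronglyMeasurable]
    simp [F]
  rw [← hzero]
  refine Tendsto.congr' ?_ hlim
  filter_upwards [hr.eventually_gt_atTop 0] with n hn
  have htn : t n ≠ 0 := inv_ne_zero (Real.toNNReal_pos.2 hn).ne'
  have htr : (t n : ℝ) = (r n)⁻¹ := by simp [t, hn.le]
  change ∫ p, f (F p) ∂((Measure.dirac (t n)).prod (ν n : Measure H)) = _
  rw [hint]
  change ∫ y, f (F (t n, y)) ∂((P n).map fun ω => r n • (M n ω - m)) = _
  refine (integral_map (hM n).aemeasurable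
    (f.continuous.comp (hF.comp (by fun_prop))).measurable.aestronglyMeasurable).trans ?_
  refine integral_congr_ae (Eventually.of_forall fun ω => ?_)
  simp [F, htn, htr, smul_smul, inv_mul_cancel₀ hn.ne']

/-- The objective `f ↦ ∑_{u,v} Γ(u,v) f(v,x)` as a linear functional. -/
def transportPairing {G X : Type} [Fintype G] (x : X) (Γ : G → G → ℝ) : (G × X → ℝ) →ₗ[ℝ] ℝ where
  toFun f := ∑ u, ∑ v, Γ u v * f (v, x)
  map_add' f g := by simp [mul_add, Finset.sum_add_distrib]
  map_smul' c f := by simp [Finset.mul_sum, mul_left_comm]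

theorem continuous_transportPairing {G X : Type} [Fintype G] (x : X) :
    Continuous fun p : (G → G → ℝ) × (G × X → ℝ) => transportPairing x p.1 p.2 := by
  change Continuous fun p : (G → G → ℝ) × (G × X → ℝ) => ∑ u, ∑ v, p.1 u v * p.2 (v, x)
  fun_prop

theorem isCompact_feasSet (G : Type) [Fintype G] (val : G → ℕ) (q δ : ℝ) (πx : G → ℝ) :
    IsCompact (FeasSet G val q δ πx) := by
  refine (isCompact_Icc (a := (0 : G → G → ℝ)) (b := fun u _ => πx u)).of_isClosed_subset ?_ ?_
  · simp only [FeasSet, Set.ofPred_and, Set.ofPred_forall]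
    refine IsClosed.inter ?_ (IsClosed.inter ?_ ?_)
    · exact isClosed_iInter fun u => isClosed_iInter fun v =>
        isClosed_le continuous_const (by fun_prop)
    · exact isClosed_iInter fun u => isClosed_eq (by fun_prop) continuous_const
    · exact isClosed_le (by fun_prop) continuous_const
  · rintro Γ ⟨h0, h1, -⟩
    exact ⟨h0, fun u v =>
      (Finset.single_le_sum (fun w _ => h0 u w) (Finset.mem_univ v)).trans_eq (h1 u)⟩

theorem feasSet_nonempty (G : Type) [Fintype G] (val : G → ℕ) {q δ : ℝ} (hq : 1 ≤ q) (hδ : 0 < δ)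
    {πx : G → ℝ} (hπ : ∀ g, 0 ≤ πx g) : (FeasSet G val q δ πx).Nonempty := by
  classical
  refine ⟨fun u v => if u = v then πx u else 0, fun u v => ?_, fun u => by simp, ?_⟩
  · dsimp only
    split_ifs
    exacts [hπ u, le_rfl]
  · simpa [ite_mul, Real.zero_rpow (by linarith : q ≠ 0)] using Real.rpow_nonneg hδ.le q

/-- **Delta-method form of Theorem 1.**  If the law of `√n (M_n − m)` converges weakly
to a Borel probability measure `μ` on `ℝ^{𝒢×𝒳}`, then the law of
`√n (φ(M_n) − φ(m))` converges weakly to the pushforward of `μ` under the map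
`h ↦ ∑_x max_{Γ ∈ S*_x} ∑_{u,v} Γ(u,v) h(v,x)`.  Weak convergence of laws is encoded
by convergence of integrals of bounded continuous test functions. -/
theorem stmt_5
    (G : Type) [Fintype G] [Nonempty G] (val : G → ℕ) (hval : Function.Injective val)
    (X : Type) [Fintype X] [Nonempty X]
    (πstar : X → G → ℝ)
    (hπ : ∀ x, (∀ g, 0 ≤ πstar x g) ∧ ∑ g, πstar x g = 1)
    (q δ : ℝ) (hq : 1 ≤ q) (hδ : 0 < δ)
    (m : G × X → ℝ)
    (Ω : ℕ → Type) [∀ n, MeasurableSpace (Ω n)]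
    (P : ∀ n, Measure (Ω n)) [∀ n, IsProbabilityMeasure (P n)]
    (M : ∀ n, Ω n → (G × X → ℝ)) (hM : ∀ n, Measurable (M n))
    (μ : Measure (G × X → ℝ)) [IsProbabilityMeasure μ]
    (hweak : ∀ fb : BoundedContinuousFunction ((G × X) → ℝ) ℝ,
      Tendsto (fun n : ℕ =>
          ∫ ω, fb (fun p => Real.sqrt n * (M n ω p - m p)) ∂(P n))
        atTop (𝓝 (∫ y, fb y ∂μ))) :
    ∀ fb : BoundedContinuousFunction ℝ ℝ,
      Tendsto (fun n : ℕ =>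
          ∫ ω, fb (Real.sqrt n *
            (lpValue G X val q δ πstar (M n ω) - lpValue G X val q δ πstar m)) ∂(P n))
        atTop
        (𝓝 (∫ y, fb y ∂(μ.map (derivMap G X val q δ πstar m)))) := by
  have hK x := isCompact_feasSet G val q δ (πstar x)
  have hne x := feasSet_nonempty G val hq hδ (hπ x).1
  have hcont (x : X) {K : Set (G → G → ℝ)} (hK : IsCompact K) :
      Continuous fun f : G × X → ℝ => sSup ((fun Γ => transportPairing x Γ f) '' K) :=
    hK.continuous_sSup ((continuous_transportPairing x).comp continuous_swap)
  have hS x : IsCompact (SstarSet G X val q δ πstar m x) :=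
    (hK x).inter_right (isClosed_eq (by fun_prop) continuous_const)
  have hφ : Continuous (lpValue G X val q δ πstar) :=
    continuous_finsetSum _ fun x _ => hcont x (hK x)
  have hT : Continuous (derivMap G X val q δ πstar m) :=
    continuous_finsetSum _ fun x _ => hcont x (hS x)
  refine tendsto_integral_delta_method hφ hT (m := m) (fun h => ?_)
    (r := fun n : ℕ => Real.sqrt n) (Real.tendsto_sqrt_atTop.comp tendsto_natCast_atTop_atTop) P
    (M := M) (fun n => ((hM n).sub_const m).const_smul _) μ hweak
  refine (tendsto_finsetSum Finset.univ fun x _ =>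
    (hK x).tendsto_supportFunction_slope (continuous_transportPairing x) (hne x) m h).congr
      fun p => ?_
  rw [← Finset.mul_sum, Finset.sum_sub_distrib]
  rfl
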